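/- Let c ≥ 1 be a real number and let f : ℕ → ℕ be strictly increasing with lim_{n→∞} f(n)/n = c. Then the set of achievable burning densities is P(G(f)) = [1/(2c²), 1]. -/

import Mathlib

open Filter Asymptotics

/-- Membership in the grid `[-f n, f n]^2 ⊆ ℤ × ℤ`. -/
def inGrid (f : ℕ → ℕ) (n : ℕ) (p : ℤ × ℤ) : Prop :=
  |p.1| ≤ (f n : ℤ) ∧ |p.2| ≤ (f n : ℤ)

instance (f : ℕ → ℕ) (n : ℕ) : DecidablePred (inGrid f n) := fun _ => by
  unfold inGrid; infer_instance

/-- The four lattice neighbours (at `L¹`-distance one) of a point. -/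
def nbrs (p : ℤ × ℤ) : Finset (ℤ × ℤ) :=
  {(p.1 + 1, p.2), (p.1 - 1, p.2), (p.1, p.2 + 1), (p.1, p.2 - 1)}

/-- An activator sequence: whenever `V n ≠ ∅` (for `n ≥ 1`), the activated vertex
lies in the grid at time `n`. -/
def IsActivator (f : ℕ → ℕ) (V : ℕ → Option (ℤ × ℤ)) : Prop :=
  ∀ n, 1 ≤ n → ∀ p, V n = some p → inGrid f n p

/-- The burning process: `B 0 = ∅`, and `B n` is obtained from `B (n-1)` by adding all
vertices of the grid at time `n` adjacent to a vertex of `B (n-1)`, and then adding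
the activator `V n` if it is not `∅`. -/
def burnSet (f : ℕ → ℕ) (V : ℕ → Option (ℤ × ℤ)) : ℕ → Finset (ℤ × ℤ)
  | 0 => ∅
  | n + 1 =>
    let B := burnSet f V n
    let spread := B ∪ (B.biUnion nbrs).filter (inGrid f (n + 1))
    match V (n + 1) with
    | none => spread
    | some v => insert v spread

/-- The proportion `|B n| / |V(G n)|` of burning vertices at time `n`. -/
noncomputable def densitySeq (f : ℕ → ℕ) (V : ℕ → Option (ℤ × ℤ)) (n : ℕ) : ℝ :=
  ((burnSet f V n).card : ℝ) / (2 * (f n : ℝ) + 1) ^ 2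

/-- The lower burning density `δ̲(G(f), V)`. -/
noncomputable def lowerDensity (f : ℕ → ℕ) (V : ℕ → Option (ℤ × ℤ)) : ℝ :=
  liminf (densitySeq f V) atTop

/-- The upper burning density `δ̄(G(f), V)`. -/
noncomputable def upperDensity (f : ℕ → ℕ) (V : ℕ → Option (ℤ × ℤ)) : ℝ :=
  limsup (densitySeq f V) atTop

/-- The burning density of `V` in `G(f)` exists and equals `ρ`. -/
def HasBurningDensity (f : ℕ → ℕ) (V : ℕ → Option (ℤ × ℤ)) (ρ : ℝ) : Prop :=
  Tendsto (densitySeq f V) atTop (nhds ρ)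

/-- `P(G(f))`: the set of `ρ ∈ [0,1]` achievable as the burning density of some
non-empty activator sequence. -/
def densSet (f : ℕ → ℕ) : Set ℝ :=
  {ρ | ρ ∈ Set.Icc (0 : ℝ) 1 ∧
    ∃ V : ℕ → Option (ℤ × ℤ), IsActivator f V ∧ (∃ t, 1 ≤ t ∧ V t ≠ none) ∧
      HasBurningDensity f V ρ}

/-- The controlled growth requirement. -/
def ControlledGrowth (f : ℕ → ℕ) : Prop :=
  (∀ᶠ n in atTop, f n < f (n + 1)) ∧
  (∀ ε : ℕ → ℕ, (fun n => (ε n : ℝ)) =o[atTop] (fun n => (n : ℝ)) →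
    Tendsto (fun n => (f (n + ε n) : ℝ) / (f n : ℝ)) atTop (nhds 1)) ∧
  (∀ c : ℝ, 0 < c → ∃ d : ℝ, 0 < d ∧
    ∀ᶠ n in atTop, (1 + d) * (f n : ℝ) ≤ (f (n + ⌈c * n⌉₊) : ℝ))

/-- The lattice octagon `{p : |p.1| ≤ F, |p.2| ≤ F, |p.1| + |p.2| ≤ g}`. -/
noncomputable def octagon (F g : ℕ) : Finset (ℤ × ℤ) :=
  ((Finset.Icc (-F : ℤ) F) ×ˢ (Finset.Icc (-F : ℤ) F)).filter fun p => |p.1| + |p.2| ≤ (g : ℤ)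

theorem mem_octagon {F g : ℕ} {p : ℤ × ℤ} :
    p ∈ octagon F g ↔ |p.1| ≤ F ∧ |p.2| ≤ F ∧ |p.1| + |p.2| ≤ g := by
  simp only [octagon, Finset.mem_filter, Finset.mem_product, Finset.mem_Icc, abs_le, and_assoc]

theorem octagon_mono {F F' g g' : ℕ} (hF : F ≤ F') (hg : g ≤ g') :
    octagon F g ⊆ octagon F' g' := by
  intro p hp
  rw [mem_octagon] at hp ⊢
  omega

theorem octagon_min (F g : ℕ) : octagon (min F g) g = octagon F g := by
  ext p
  have := abs_nonneg p.1
  have := abs_nonneg p.2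
  rw [mem_octagon, mem_octagon]
  omega

theorem sum_Icc_neg_abs (φ : ℤ → ℤ) (F : ℕ) :
    ∑ x ∈ Finset.Icc (-F : ℤ) F, φ |x| = φ 0 + 2 * ∑ i ∈ Finset.range F, φ (i + 1) := by
  induction F with
  | zero => simp
  | succ F ih =>
    have h : Finset.Icc (-(F + 1 : ℕ) : ℤ) (F + 1 : ℕ) =
        insert ((F : ℤ) + 1) (insert (-((F : ℤ) + 1)) (Finset.Icc (-F : ℤ) F)) := by
      ext x
      simp only [Finset.mem_Icc, Finset.mem_insert]
      omega
    rw [h, Finset.sum_insert, Finset.sum_insert, ih, Finset.sum_range_succ, abs_neg,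
      abs_of_nonneg (by positivity : (0 : ℤ) ≤ F + 1)]
    · ring
    · simp only [Finset.mem_Icc]; omega
    · simp only [Finset.mem_Icc, Finset.mem_insert]; omega

theorem sum_range_min (F e k : ℕ) :
    2 * ∑ i ∈ Finset.range (e + k), min (F : ℤ) (F + e - (i + 1)) =
      2 * (e + k) * F - k * (k + 1) := by
  induction k with
  | zero =>
    have h : ∀ i ∈ Finset.range e, min (F : ℤ) (F + e - (i + 1)) = F := by
      intro i hi
      rw [Finset.mem_range] at hi
      omega
    rw [add_zero, Finset.sum_congr rfl h]
    simp
    ring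
  | succ k ih =>
    rw [← add_assoc, Finset.sum_range_succ, mul_add, ih]
    have h : min (F : ℤ) (F + e - ((e + k : ℕ) + 1)) = F - k - 1 := by push_cast; omega
    rw [h]
    push_cast
    ring

theorem card_octagon_add (F e : ℕ) (he : e ≤ F) :
    ((octagon F (F + e)).card : ℤ) = 2 * (F + e) ^ 2 + 2 * (F + e) + 1 - 4 * e ^ 2 := by
  obtain ⟨k, rfl⟩ := Nat.exists_eq_add_of_le he
  set F := e + k with hF
  have hrow : ∀ x ∈ Finset.Icc (-F : ℤ) F,
      ∑ y ∈ Finset.Icc (-F : ℤ) F, (if |x| + |y| ≤ ((F + e : ℕ) : ℤ) then (1 : ℤ) else 0) =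
        2 * min (F : ℤ) (F + e - |x|) + 1 := by
    intro x hx
    rw [Finset.mem_Icc, ← abs_le] at hx
    have hset : (Finset.Icc (-F : ℤ) F).filter (fun y => |x| + |y| ≤ ((F + e : ℕ) : ℤ)) =
        Finset.Icc (-min (F : ℤ) (F + e - |x|)) (min (F : ℤ) (F + e - |x|)) := by
      ext y
      simp only [Finset.mem_filter, Finset.mem_Icc, ← abs_le]
      push_cast
      omega
    rw [Finset.sum_boole, hset, Int.card_Icc]
    omega
  have hcard : ((octagon F (F + e)).card : ℤ) =
      ∑ x ∈ Finset.Icc (-F : ℤ) F, (2 * min (F : ℤ) (F + e - |x|) + 1) := by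
    rw [octagon, Finset.card_filter]
    push_cast
    rw [Finset.sum_product]
    refine Finset.sum_congr rfl fun x hx => ?_
    rw [← hrow x hx]
    push_cast
    rfl
  rw [hcard, sum_Icc_neg_abs (fun t => 2 * min (F : ℤ) (F + e - t) + 1), Finset.sum_add_distrib,
    ← Finset.mul_sum]
  have := sum_range_min F e k
  rw [← hF] at this
  rw [this, sub_zero, min_eq_left (by omega)]
  simp only [Finset.sum_const, Finset.card_range, nsmul_eq_mul, mul_one]
  rw [hF]
  push_cast
  ring

theorem card_octagon (F g : ℕ) (h : g ≤ 2 * F) :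
    ((octagon F g).card : ℝ) =
      2 * (g : ℝ) ^ 2 + 2 * g + 1 - 4 * ((g : ℝ) - min (F : ℝ) g) ^ 2 := by
  rw [← octagon_min, ← Nat.cast_min]
  obtain ⟨e, he⟩ := Nat.exists_eq_add_of_le (min_le_right F g)
  have key := card_octagon_add (min F g) e (by omega)
  rw [← he] at key
  have key' : ((octagon (min F g) g).card : ℝ) = 2 * ((min F g : ℕ) + e : ℝ) ^ 2 +
      2 * ((min F g : ℕ) + e : ℝ) + 1 - 4 * (e : ℝ) ^ 2 := by exact_mod_cast key
  have he' : (g : ℝ) = (min F g : ℕ) + (e : ℝ) := by exact_mod_cast he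
  rw [key', ← he', sub_eq_of_eq_add' he']

theorem tendsto_card_octagon {c a : ℝ} {f g : ℕ → ℕ}
    (hf : Tendsto (fun n => (f n : ℝ) / (n : ℝ)) atTop (nhds c))
    (hg : Tendsto (fun n => (g n : ℝ) / (n : ℝ)) atTop (nhds a)) (hle : ∀ n, g n ≤ 2 * f n) :
    Tendsto (fun n : ℕ => ((octagon (f n) (g n)).card : ℝ) / (n : ℝ) ^ 2) atTop
      (nhds (2 * a ^ 2 - 4 * (a - min c a) ^ 2)) := by
  have h0 : Tendsto (fun n : ℕ => 1 / (n : ℝ)) atTop (nhds 0) := tendsto_one_div_atTop_nhds_zero_nat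
  have h := (((hg.pow 2).const_mul 2).add ((hg.mul h0).const_mul 2)).add (h0.pow 2) |>.sub
    (((hg.sub (hf.min hg)).pow 2).const_mul 4)
  have e : 2 * a ^ 2 + 2 * (a * 0) + 0 ^ 2 - 4 * (a - min c a) ^ 2 =
      2 * a ^ 2 - 4 * (a - min c a) ^ 2 := by ring
  rw [e] at h
  refine h.congr' ?_
  filter_upwards [eventually_gt_atTop 0] with n hn
  have hn' : (0 : ℝ) < n := by exact_mod_cast hn
  rw [card_octagon _ _ (hle n), min_div_div_right hn'.le]
  field_simp

section Burning

variable {f : ℕ → ℕ} {V : ℕ → Option (ℤ × ℤ)}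

theorem mem_nbrs {p q : ℤ × ℤ} : q ∈ nbrs p ↔ |q.1 - p.1| + |q.2 - p.2| = 1 := by
  obtain ⟨a, b⟩ := p
  obtain ⟨x, y⟩ := q
  simp only [nbrs, Finset.mem_insert, Finset.mem_singleton, Prod.mk.injEq, Int.abs_eq_natAbs]
  omega

theorem mem_burnSet_succ {n : ℕ} {q : ℤ × ℤ} :
    q ∈ burnSet f V (n + 1) ↔ V (n + 1) = some q ∨ q ∈ burnSet f V n ∨
      (∃ p ∈ burnSet f V n, q ∈ nbrs p) ∧ inGrid f (n + 1) q := by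
  rw [burnSet]
  cases h : V (n + 1) with
  | none => simp
  | some v => simp [eq_comm]

theorem burnSet_mono : Monotone (burnSet f V) :=
  monotone_nat_of_le_succ fun _ _ hq => mem_burnSet_succ.2 (Or.inr (Or.inl hq))

theorem mem_burnSet_of_activated {n : ℕ} {q : ℤ × ℤ} (hn : 1 ≤ n) (h : V n = some q) :
    q ∈ burnSet f V n := by
  obtain ⟨m, rfl⟩ := Nat.exists_eq_add_of_le' hn
  exact mem_burnSet_succ.2 (Or.inl h)

/-- A family of sets containing the activators and closed under spreading contains the burning
set. -/
theorem burnSet_subset {S : ℕ → Finset (ℤ × ℤ)} (hV : ∀ n, 1 ≤ n → ∀ p, V n = some p → p ∈ S n)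
    (hmono : Monotone S)
    (hS : ∀ n, ∀ p ∈ S n, ∀ q ∈ nbrs p, inGrid f (n + 1) q → q ∈ S (n + 1)) (n : ℕ) :
    burnSet f V n ⊆ S n := by
  induction n with
  | zero => simp [burnSet]
  | succ n ih =>
    intro q hq
    rcases mem_burnSet_succ.1 hq with h | h | ⟨⟨p, hp, hpq⟩, h⟩
    · exact hV _ (by omega) _ h
    · exact hmono n.le_succ (ih h)
    · exact hS n p (ih hp) q hpq h

theorem inGrid_of_mem_burnSet (hf : StrictMono f) (hV : IsActivator f V) {n : ℕ} {p : ℤ × ℤ}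
    (hp : p ∈ burnSet f V n) : inGrid f n p := by
  have key : ∀ n p, inGrid f n p ↔ p ∈ octagon (f n) (2 * f n) := by
    intro n p
    rw [mem_octagon, inGrid]
    push_cast
    omega
  rw [key]
  refine burnSet_subset (S := fun n => octagon (f n) (2 * f n)) ?_ ?_ ?_ n hp
  · exact fun n hn p h => (key n p).1 (hV n hn p h)
  · exact fun m n h => octagon_mono (hf.monotone h) (Nat.mul_le_mul_left 2 (hf.monotone h))
  · exact fun n p _ q _ h => (key _ q).1 h

theorem exists_mem_nbrs_closer {p q : ℤ × ℤ} (h : p ≠ q) :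
    ∃ q', q ∈ nbrs q' ∧ |q'.1 - p.1| + |q'.2 - p.2| + 1 = |q.1 - p.1| + |q.2 - p.2| := by
  simp only [mem_nbrs, Int.abs_eq_natAbs]
  obtain ⟨a, b⟩ := p
  obtain ⟨x, y⟩ := q
  rcases lt_trichotomy x a with hx | hx | hx
  · exact ⟨(x + 1, y), by dsimp only; omega⟩
  · rcases lt_trichotomy y b with hy | hy | hy
    · exact ⟨(x, y + 1), by dsimp only; omega⟩
    · exact absurd (by rw [hx, hy]) h
    · exact ⟨(x, y - 1), by dsimp only; omega⟩
  · exact ⟨(x - 1, y), by dsimp only; omega⟩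

theorem mem_burnSet_add (hf : StrictMono f) (hV : IsActivator f V) {t : ℕ} {p : ℤ × ℤ}
    (hp : p ∈ burnSet f V t) (r : ℕ) (q : ℤ × ℤ) (hq : |q.1 - p.1| + |q.2 - p.2| ≤ r) :
    q ∈ burnSet f V (t + r) := by
  induction r generalizing q with
  | zero =>
    rw [Int.abs_eq_natAbs, Int.abs_eq_natAbs] at hq
    have : q = p := Prod.ext (by omega) (by omega)
    rwa [this]
  | succ r ih =>
    by_cases hpq : p = q
    · exact burnSet_mono (by omega) (hpq ▸ hp)
    obtain ⟨q', hq', hd⟩ := exists_mem_nbrs_closer hpq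
    have hq'B := ih q' (by push_cast at hq; omega)
    rw [← add_assoc]
    refine mem_burnSet_succ.2 (Or.inr (Or.inr ⟨⟨q', hq'B, hq'⟩, ?_⟩))
    have hg := inGrid_of_mem_burnSet hf hV hq'B
    have hlt := hf (Nat.lt_add_one (t + r))
    rw [mem_nbrs] at hq'
    simp only [inGrid, Int.abs_eq_natAbs] at hg hq' ⊢
    omega

theorem le_card_burnSet (hf : StrictMono f) (hV : IsActivator f V) {t : ℕ} {p : ℤ × ℤ}
    (ht : 1 ≤ t) (hp : V t = some p) (r : ℕ) :
    2 * r ^ 2 ≤ (burnSet f V (t + r)).card := by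
  have hsub : (octagon r r).map (Equiv.addRight p).toEmbedding ⊆ burnSet f V (t + r) := by
    intro q hq
    obtain ⟨x, hx, rfl⟩ := Finset.mem_map.1 hq
    refine mem_burnSet_add hf hV (mem_burnSet_of_activated ht hp) r _ ?_
    simpa using (mem_octagon.1 hx).2.2
  have h1 := Finset.card_le_card hsub
  rw [Finset.card_map] at h1
  have h2 := card_octagon_add r 0 (Nat.zero_le r)
  simp only [add_zero, Nat.cast_zero] at h2
  zify at h1 ⊢
  nlinarith

end Burning

theorem tendsto_grid_card {c : ℝ} {f : ℕ → ℕ}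
    (hf : Tendsto (fun n => (f n : ℝ) / (n : ℝ)) atTop (nhds c)) :
    Tendsto (fun n : ℕ => (2 * (f n : ℝ) + 1) ^ 2 / (n : ℝ) ^ 2) atTop (nhds (4 * c ^ 2)) := by
  have h0 : Tendsto (fun n : ℕ => 1 / (n : ℝ)) atTop (nhds 0) := tendsto_one_div_atTop_nhds_zero_nat
  have h := ((hf.const_mul 2).add h0).pow 2
  have e : (2 * c + 0) ^ 2 = 4 * c ^ 2 := by ring
  rw [e] at h
  refine h.congr fun n => ?_
  rw [← div_pow]
  congr 1
  ring

theorem lower_bound_of_hasBurningDensity {c : ℝ} (hc : 1 ≤ c) {f : ℕ → ℕ} (hf : StrictMono f)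
    (hlim : Tendsto (fun n => (f n : ℝ) / (n : ℝ)) atTop (nhds c)) {V : ℕ → Option (ℤ × ℤ)}
    (hV : IsActivator f V) (hne : ∃ t, 1 ≤ t ∧ V t ≠ none) {ρ : ℝ}
    (hρ : HasBurningDensity f V ρ) : 1 / (2 * c ^ 2) ≤ ρ := by
  obtain ⟨t, ht, hVt⟩ := hne
  obtain ⟨p, hp⟩ := Option.ne_none_iff_exists'.1 hVt
  have h0 : Tendsto (fun n : ℕ => (t : ℝ) / (n : ℝ)) atTop (nhds 0) :=
    tendsto_const_div_atTop_nhds_zero_nat _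
  have h := ((h0.const_sub 1).pow 2 |>.const_mul 2).div (tendsto_grid_card hlim) (by positivity)
  have e : 2 * ((1 : ℝ) - 0) ^ 2 / (4 * c ^ 2) = 1 / (2 * c ^ 2) := by field_simp; norm_num
  rw [e] at h
  refine le_of_tendsto_of_tendsto h hρ ?_
  filter_upwards [eventually_ge_atTop t] with n hn
  obtain ⟨r, rfl⟩ := Nat.exists_eq_add_of_le hn
  have hcard : (2 * (r : ℝ) ^ 2) ≤ (burnSet f V (t + r)).card := by
    exact_mod_cast le_card_burnSet hf hV ht hp r
  have hpos : (0 : ℝ) < (t + r : ℕ) := by exact_mod_cast (by omega : 0 < t + r)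
  have hr : 2 * (1 - (t : ℝ) / (t + r : ℕ)) ^ 2 = 2 * (r : ℝ) ^ 2 / ((t + r : ℕ) : ℝ) ^ 2 := by
    push_cast at hpos ⊢
    field_simp
    ring
  simp only [Pi.div_apply, densitySeq]
  rw [hr, div_div_div_cancel_right₀ (by positivity)]
  gcongr

theorem exists_octagon_area {c : ℝ} (hc : 1 ≤ c) {ρ : ℝ} (hρ : ρ ∈ Set.Icc (1 / (2 * c ^ 2)) 1) :
    ∃ a ∈ Set.Icc 1 (2 * c), 2 * a ^ 2 - 4 * (a - min c a) ^ 2 = ρ * (4 * c ^ 2) := by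
  have hcont : ContinuousOn (fun a : ℝ => 2 * a ^ 2 - 4 * (a - min c a) ^ 2)
      (Set.Icc 1 (2 * c)) := by fun_prop
  have hivt := intermediate_value_Icc (by linarith) hcont
  have hc2 : 0 < c ^ 2 := by positivity
  obtain ⟨a, ha, h⟩ := hivt (show ρ * (4 * c ^ 2) ∈ _ from by
    rw [min_eq_right hc, min_eq_left (by linarith)]
    have h1 := mul_le_mul_of_nonneg_right hρ.1 (by positivity : 0 ≤ 4 * c ^ 2)
    have h2 := mul_le_mul_of_nonneg_right hρ.2 (by positivity : 0 ≤ 4 * c ^ 2)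
    have h3 : 1 / (2 * c ^ 2) * (4 * c ^ 2) = 2 := by field_simp; norm_num
    constructor <;> nlinarith)
  exact ⟨a, ha, h⟩

/-- The point proposed at time `n`: between the times `j ^ 4` and `(j + 1) ^ 4`, the points of the
lattice of mesh `M * j ^ 3` are enumerated, starting from the ones in the square
`[-M * j ^ 4, M * j ^ 4] ^ 2`. -/
def latticePoint (M n : ℕ) : ℤ × ℤ :=
  let j := n.sqrt.sqrt
  let i := n - j ^ 4
  ((((i / (2 * j + 1) : ℕ) : ℤ) - j) * (M * j ^ 3), (((i % (2 * j + 1) : ℕ) : ℤ) - j) * (M * j ^ 3))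

/-- Activate the proposed lattice point whenever it belongs to the target octagon. -/
noncomputable def latticeActivator (f g : ℕ → ℕ) (M n : ℕ) : Option (ℤ × ℤ) :=
  if latticePoint M n ∈ octagon (f n) (g n) then some (latticePoint M n) else none

theorem sqrt_sqrt_eq {n j : ℕ} (h1 : j ^ 4 ≤ n) (h2 : n < (j + 1) ^ 4) : n.sqrt.sqrt = j := by
  refine le_antisymm ?_ ?_
  · rw [← Nat.lt_succ_iff, Nat.sqrt_lt', Nat.sqrt_lt']
    calc n < (j + 1) ^ 4 := h2
      _ = _ := by rw [Nat.succ_eq_add_one]; ring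
  · rw [Nat.le_sqrt', Nat.le_sqrt']
    calc _ = j ^ 4 := by ring
      _ ≤ n := h1

theorem sqrt_sqrt_pow_le (n : ℕ) : n.sqrt.sqrt ^ 4 ≤ n :=
  calc n.sqrt.sqrt ^ 4 = (n.sqrt.sqrt ^ 2) ^ 2 := by ring
    _ ≤ n.sqrt ^ 2 := Nat.pow_le_pow_left (Nat.sqrt_le' _) 2
    _ ≤ n := Nat.sqrt_le' _

theorem lt_sqrt_sqrt_succ_pow (n : ℕ) : n < (n.sqrt.sqrt + 1) ^ 4 := by
  have h1 : n < (n.sqrt + 1) ^ 2 := Nat.lt_succ_sqrt' n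
  have h2 : n.sqrt + 1 ≤ (n.sqrt.sqrt + 1) ^ 2 := Nat.lt_succ_sqrt' n.sqrt
  calc n < (n.sqrt + 1) ^ 2 := h1
    _ ≤ ((n.sqrt.sqrt + 1) ^ 2) ^ 2 := Nat.pow_le_pow_left h2 2
    _ = _ := by ring

theorem exists_latticePoint_eq (M j : ℕ) {u v : ℤ} (hu : |u| ≤ j) (hv : |v| ≤ j) :
    ∃ i < (2 * j + 1) ^ 2, latticePoint M (j ^ 4 + i) = (u * (M * j ^ 3), v * (M * j ^ 3)) := by
  rw [abs_le] at hu hv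
  obtain ⟨x, hx⟩ := Int.eq_ofNat_of_zero_le (by omega : 0 ≤ u + j)
  obtain ⟨y, hy⟩ := Int.eq_ofNat_of_zero_le (by omega : 0 ≤ v + j)
  have hx' : x < 2 * j + 1 := by omega
  have hy' : y < 2 * j + 1 := by omega
  have hi : (2 * j + 1) * x + y < (2 * j + 1) ^ 2 := by nlinarith
  refine ⟨(2 * j + 1) * x + y, hi, ?_⟩
  have hj : (j ^ 4 + ((2 * j + 1) * x + y)).sqrt.sqrt = j :=
    sqrt_sqrt_eq (Nat.le_add_right _ _) (by
      have : (j + 1) ^ 4 = j ^ 4 + (2 * j + 1) ^ 2 + (4 * j ^ 3 + 2 * j ^ 2) := by ring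
      omega)
  have hdiv : ((2 * j + 1) * x + y) / (2 * j + 1) = x := by
    rw [Nat.mul_add_div (by omega), Nat.div_eq_of_lt hy', add_zero]
  have hmod : ((2 * j + 1) * x + y) % (2 * j + 1) = y := by
    rw [Nat.mul_add_mod, Nat.mod_eq_of_lt hy']
  rw [latticePoint, hj, Nat.add_sub_cancel_left, hdiv, hmod, ← eq_sub_of_add_eq hx, ← eq_sub_of_add_eq hy]

/-- Rounding towards zero to a multiple of `s`. -/
theorem exists_round_toward_zero {s j : ℕ} (hs : 0 < s) {x : ℤ} (hx : |x| ≤ j * s) :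
    ∃ u : ℤ, |u| ≤ j ∧ |u * s| ≤ |x| ∧ |x - u * s| ≤ s := by
  have hs' : (0 : ℤ) < s := by exact_mod_cast hs
  wlog h : 0 ≤ x generalizing x
  · obtain ⟨u, h1, h2, h3⟩ := this (x := -x) (by rwa [abs_neg]) (by omega)
    refine ⟨-u, by rwa [abs_neg], by rwa [neg_mul, abs_neg, ← abs_neg x], ?_⟩
    rw [← abs_neg]
    convert h3 using 2
    ring
  rw [abs_of_nonneg h] at hx
  have hu : 0 ≤ x / s := Int.ediv_nonneg h hs'.le
  have h1 := Int.ediv_mul_le x hs'.ne'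
  have h2 := Int.lt_ediv_add_one_mul_self x hs'
  refine ⟨x / s, ?_, ?_, ?_⟩
  · rw [abs_of_nonneg hu]
    exact Int.ediv_le_of_le_mul hs' hx
  · rwa [abs_of_nonneg (mul_nonneg hu hs'.le), abs_of_nonneg h]
  · rw [abs_of_nonneg (by linarith)]
    linarith

section LatticeActivator

variable {f g : ℕ → ℕ} {M : ℕ}

theorem mem_octagon_of_latticeActivator {n : ℕ} {p : ℤ × ℤ}
    (h : latticeActivator f g M n = some p) : p ∈ octagon (f n) (g n) := by
  unfold latticeActivator at h
  split_ifs at h with h'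
  rwa [← Option.some.inj h]

theorem isActivator_latticeActivator : IsActivator f (latticeActivator f g M) := by
  intro n _ p h
  have := mem_octagon.1 (mem_octagon_of_latticeActivator h)
  exact ⟨this.1, this.2.1⟩

theorem latticeActivator_ne_none : ∃ t, 1 ≤ t ∧ latticeActivator f g M t ≠ none := by
  obtain ⟨i, -, hi⟩ := exists_latticePoint_eq M 1 (u := 0) (v := 0) (by simp) (by simp)
  refine ⟨1 ^ 4 + i, by omega, ?_⟩
  have : latticePoint M (1 ^ 4 + i) ∈ octagon (f (1 ^ 4 + i)) (g (1 ^ 4 + i)) := by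
    rw [hi, mem_octagon]
    simp
  rw [latticeActivator, if_pos this]
  exact Option.some_ne_none _

theorem burnSet_latticeActivator_subset (hf : StrictMono f) (hg : StrictMono g) (n : ℕ) :
    burnSet f (latticeActivator f g M) n ⊆ octagon (f n) (g n) := by
  refine burnSet_subset (S := fun n => octagon (f n) (g n))
    (fun n _ p h => mem_octagon_of_latticeActivator h)
    (fun m n h => octagon_mono (hf.monotone h) (hg.monotone h)) ?_ n
  intro n p hp q hq hgrid
  have hlt := hg (Nat.lt_add_one n)
  rw [mem_nbrs] at hq
  rw [mem_octagon] at hp ⊢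
  refine ⟨hgrid.1, hgrid.2, ?_⟩
  simp only [Int.abs_eq_natAbs] at hp hq ⊢
  omega

theorem octagon_subset_burnSet (hf : StrictMono f) (hg : StrictMono g) (hM : 0 < M)
    (hfM : ∀ n, 1 ≤ n → f n ≤ M * n) {j : ℕ} (hj : 1 ≤ j) :
    octagon (f (j ^ 4)) (g (j ^ 4)) ⊆
      burnSet f (latticeActivator f g M) (j ^ 4 + (2 * j + 1) ^ 2 + 2 * (M * j ^ 3)) := by
  intro q hq
  have hq' := mem_octagon.1 hq
  have hs : 0 < M * j ^ 3 := by positivity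
  have hfj : (f (j ^ 4) : ℤ) ≤ j * (M * j ^ 3 : ℕ) := by
    have := hfM (j ^ 4) (Nat.one_le_pow _ _ hj)
    have e : M * j ^ 4 = j * (M * j ^ 3) := by ring
    rw [e] at this
    exact_mod_cast this
  obtain ⟨u, hu1, hu2, hu3⟩ := exists_round_toward_zero hs (hq'.1.trans hfj)
  obtain ⟨v, hv1, hv2, hv3⟩ := exists_round_toward_zero hs (hq'.2.1.trans hfj)
  obtain ⟨i, hi, hp⟩ := exists_latticePoint_eq M j hu1 hv1
  push_cast at hu2 hu3 hv2 hv3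
  have hmem : latticePoint M (j ^ 4 + i) ∈ octagon (f (j ^ 4 + i)) (g (j ^ 4 + i)) := by
    refine octagon_mono (hf.monotone (Nat.le_add_right _ i)) (hg.monotone (Nat.le_add_right _ i)) ?_
    rw [hp, mem_octagon]
    exact ⟨hu2.trans hq'.1, hv2.trans hq'.2.1, (add_le_add hu2 hv2).trans hq'.2.2⟩
  have hact : latticeActivator f g M (j ^ 4 + i) = some (u * (M * j ^ 3), v * (M * j ^ 3)) := by
    rw [latticeActivator, if_pos hmem, hp]
  have hB := mem_burnSet_of_activated (f := f)
    (le_add_right (Nat.one_le_pow _ _ hj)) hact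
  refine burnSet_mono (by omega) (mem_burnSet_add hf isActivator_latticeActivator hB
    (2 * (M * j ^ 3)) q ?_)
  push_cast
  linarith

theorem octagon_sub_subset_burnSet (hf : StrictMono f) (hg : StrictMono g) (hM : 0 < M)
    (hfM : ∀ n, 1 ≤ n → f n ≤ M * n) {n : ℕ} (hn : M + 1 < n.sqrt.sqrt) :
    octagon (f ((n.sqrt.sqrt - (M + 1)) ^ 4)) (g ((n.sqrt.sqrt - (M + 1)) ^ 4)) ⊆
      burnSet f (latticeActivator f g M) n := by
  obtain ⟨k, hk⟩ := Nat.exists_eq_add_of_le hn.le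
  have hle := sqrt_sqrt_pow_le n
  rw [hk] at hle hn ⊢
  rw [Nat.add_sub_cancel_left]
  refine (octagon_subset_burnSet hf hg hM hfM (by omega)).trans (burnSet_mono (le_trans ?_ hle))
  calc k ^ 4 + (2 * k + 1) ^ 2 + 2 * (M * k ^ 3)
      ≤ k ^ 4 + (2 * k + 1) ^ 2 + 2 * (M * k ^ 3) + (2 * M * k ^ 3 + 4 * k ^ 3 +
        (6 * M ^ 2 + 12 * M + 2) * k ^ 2 + 4 * (M ^ 3 + 3 * M ^ 2 + 3 * M) * k +
        (M ^ 4 + 4 * M ^ 3 + 6 * M ^ 2 + 4 * M)) := Nat.le_add_right _ _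
    _ = (M + 1 + k) ^ 4 := by ring

end LatticeActivator

theorem tendsto_sqrt_sqrt : Tendsto (fun n : ℕ => n.sqrt.sqrt) atTop atTop := by
  refine tendsto_atTop_atTop.2 fun b => ⟨b ^ 4, fun n hn => ?_⟩
  by_contra! h
  have := lt_sqrt_sqrt_succ_pow n
  exact absurd (this.trans_le (Nat.pow_le_pow_left h 4)) (not_lt.2 hn)

theorem tendsto_sqrt_sqrt_sub_pow_div (C : ℕ) :
    Tendsto (fun n : ℕ => (((n.sqrt.sqrt - C) ^ 4 : ℕ) : ℝ) / (n : ℝ)) atTop (nhds 1) := by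
  have h0 : Tendsto (fun j : ℕ => ((C : ℝ) + 1) / ((j : ℝ) + 1)) atTop (nhds 0) :=
    ((tendsto_const_div_atTop_nhds_zero_nat ((C : ℝ) + 1)).comp (tendsto_add_atTop_nat 1)).congr
      fun j => by simp
  have h1 : Tendsto (fun n : ℕ => (1 - ((C : ℝ) + 1) / ((n.sqrt.sqrt : ℝ) + 1)) ^ 4) atTop
      (nhds 1) := by
    have := ((h0.const_sub 1).pow 4).comp tendsto_sqrt_sqrt
    rwa [sub_zero, one_pow] at this
  refine tendsto_of_tendsto_of_tendsto_of_le_of_le' h1 tendsto_const_nhds ?_ ?_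
  · filter_upwards [tendsto_sqrt_sqrt.eventually_ge_atTop C, eventually_gt_atTop 0] with n hn hpos
    have hpos' : (0 : ℝ) < n := by exact_mod_cast hpos
    have e : 1 - ((C : ℝ) + 1) / ((n.sqrt.sqrt : ℝ) + 1) =
        ((n.sqrt.sqrt - C : ℕ) : ℝ) / ((n.sqrt.sqrt : ℝ) + 1) := by
      rw [Nat.cast_sub hn]
      field_simp
      ring
    have hlt : (n : ℝ) ≤ ((n.sqrt.sqrt : ℝ) + 1) ^ 4 := by
      exact_mod_cast (lt_sqrt_sqrt_succ_pow n).le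
    rw [e, div_pow, Nat.cast_pow]
    gcongr
  · filter_upwards [eventually_gt_atTop 0] with n hpos
    have hpos' : (0 : ℝ) < n := by exact_mod_cast hpos
    rw [div_le_one hpos']
    exact_mod_cast (Nat.pow_le_pow_left (Nat.sub_le _ C) 4).trans (sqrt_sqrt_pow_le n)

theorem hasBurningDensity_latticeActivator {c a ρ : ℝ} (hc : 0 < c) {f g : ℕ → ℕ} {M : ℕ}
    (hf : StrictMono f) (hg : StrictMono g) (hle : ∀ n, g n ≤ 2 * f n)
    (hflim : Tendsto (fun n => (f n : ℝ) / (n : ℝ)) atTop (nhds c))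
    (hglim : Tendsto (fun n => (g n : ℝ) / (n : ℝ)) atTop (nhds a)) (hM : 0 < M)
    (hfM : ∀ n, 1 ≤ n → f n ≤ M * n)
    (ha : 2 * a ^ 2 - 4 * (a - min c a) ^ 2 = ρ * (4 * c ^ 2)) :
    HasBurningDensity f (latticeActivator f g M) ρ := by
  have hT := tendsto_card_octagon hflim hglim hle
  rw [ha] at hT
  set m : ℕ → ℕ := fun n => (n.sqrt.sqrt - (M + 1)) ^ 4 with hm
  have hm1 : Tendsto (fun n => (m n : ℝ) / (n : ℝ)) atTop (nhds 1) :=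
    tendsto_sqrt_sqrt_sub_pow_div (M + 1)
  have hmtop : Tendsto m atTop atTop :=
    (tendsto_pow_atTop (by norm_num)).comp
      ((tendsto_sub_atTop_nat (M + 1)).comp tendsto_sqrt_sqrt)
  have hTm : Tendsto (fun n : ℕ => ((octagon (f (m n)) (g (m n))).card : ℝ) / (n : ℝ) ^ 2) atTop
      (nhds (ρ * (4 * c ^ 2))) := by
    have h := (hT.comp hmtop).mul (hm1.pow 2)
    rw [one_pow, mul_one] at h
    refine h.congr' ?_
    filter_upwards [hmtop.eventually_gt_atTop 0] with n hn
    have hn' : (m n : ℝ) ≠ 0 := by exact_mod_cast hn.ne'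
    simp only [Function.comp_apply]
    field_simp
  have hB : Tendsto (fun n : ℕ => ((burnSet f (latticeActivator f g M) n).card : ℝ) / (n : ℝ) ^ 2)
      atTop (nhds (ρ * (4 * c ^ 2))) := by
    refine tendsto_of_tendsto_of_tendsto_of_le_of_le' hTm hT ?_ ?_
    · filter_upwards [tendsto_sqrt_sqrt.eventually_gt_atTop (M + 1)] with n hn
      gcongr
      exact octagon_sub_subset_burnSet hf hg hM hfM hn
    · filter_upwards with n
      gcongr
      exact burnSet_latticeActivator_subset hf hg n
  have h := hB.div (tendsto_grid_card hflim) (by positivity)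
  rw [mul_div_cancel_right₀ _ (by positivity)] at h
  refine h.congr' ?_
  filter_upwards [eventually_gt_atTop 0] with n hn
  have hn' : (n : ℝ) ≠ 0 := by exact_mod_cast hn.ne'
  simp only [Pi.div_apply, densitySeq]
  rw [div_div_div_cancel_right₀ (by positivity)]

theorem exists_linear_bound {c : ℝ} {f : ℕ → ℕ}
    (hf : Tendsto (fun n => (f n : ℝ) / (n : ℝ)) atTop (nhds c)) :
    ∃ M : ℕ, 0 < M ∧ ∀ n, 1 ≤ n → f n ≤ M * n := by
  obtain ⟨K, hK⟩ := hf.bddAbove_range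
  obtain ⟨M, hM⟩ := exists_nat_gt (max K 0)
  refine ⟨M, by exact_mod_cast (le_max_right K 0).trans_lt hM, fun n hn => ?_⟩
  have hn' : (0 : ℝ) < n := by exact_mod_cast hn
  have h1 : (f n : ℝ) / n ≤ M :=
    (hK (Set.mem_range_self n)).trans ((le_max_left K 0).trans hM.le)
  rw [div_le_iff₀ hn'] at h1
  exact_mod_cast h1

/-- The `L¹`-radius of the target octagons. -/
theorem exists_radius {a c : ℝ} (ha : a ∈ Set.Icc 1 (2 * c)) {f : ℕ → ℕ} (hf : StrictMono f)
    (hlim : Tendsto (fun n => (f n : ℝ) / (n : ℝ)) atTop (nhds c)) :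
    ∃ g : ℕ → ℕ, StrictMono g ∧ (∀ n, g n ≤ 2 * f n) ∧
      Tendsto (fun n => (g n : ℝ) / (n : ℝ)) atTop (nhds a) := by
  have ha0 : 0 ≤ a := zero_le_one.trans ha.1
  refine ⟨fun n => min ⌊a * n⌋₊ (2 * f n), strictMono_nat_of_lt_succ fun n => ?_,
    fun n => min_le_right _ _, ?_⟩
  · have h1 : ⌊a * n⌋₊ + 1 ≤ ⌊a * (n + 1 : ℕ)⌋₊ := by
      rw [← Nat.floor_add_one (by positivity)]
      refine Nat.floor_le_floor ?_
      push_cast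
      linarith [ha.1]
    have h2 := hf (Nat.lt_add_one n)
    omega
  · have h1 : Tendsto (fun n : ℕ => (⌊a * n⌋₊ : ℝ) / n) atTop (nhds a) :=
      (tendsto_nat_floor_mul_div_atTop ha0).comp tendsto_natCast_atTop_atTop
    have h := h1.min (hlim.const_mul 2)
    rw [min_eq_left ha.2] at h
    refine h.congr fun n => ?_
    rw [← mul_div_assoc, min_div_div_right n.cast_nonneg]
    push_cast
    rfl

/-- if `f` is strictly increasing with `f(n)/n → c` for some `c ≥ 1`,
then `P(G(f)) = [1/(2c²), 1]`. -/
theorem burning_density_asymptotically_linear (c : ℝ) (hc : 1 ≤ c) (f : ℕ → ℕ)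
    (hmono : StrictMono f)
    (hlim : Tendsto (fun n => (f n : ℝ) / (n : ℝ)) atTop (nhds c)) :
    densSet f = Set.Icc (1 / (2 * c ^ 2)) 1 := by
  refine Set.Subset.antisymm ?_ ?_
  · rintro ρ ⟨hρ, V, hV, hne, hdens⟩
    exact ⟨lower_bound_of_hasBurningDensity hc hmono hlim hV hne hdens, hρ.2⟩
  · intro ρ hρ
    obtain ⟨a, ha, hρa⟩ := exists_octagon_area hc hρ
    obtain ⟨g, hg, hle, hglim⟩ := exists_radius ha hmono hlim
    obtain ⟨M, hM, hfM⟩ := exists_linear_bound hlim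
    exact ⟨⟨le_trans (by positivity) hρ.1, hρ.2⟩, latticeActivator f g M,
      isActivator_latticeActivator, latticeActivator_ne_none,
      hasBurningDensity_latticeActivator (by linarith) hmono hg hle hlim hglim hM hfM hρa⟩
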